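/- Let S ∈ ℤ[[s,z]] be the power series in which the coefficient of s^k z^n is the number of nonempty partitions λ with sp(λ) = n and ds(λ) = k, and let Q(z) = 1 − 2z²C(z²), where C(z²) = Σ_{m≥0} Cat_m z^{2m} (so Q is the power-series square root of 1−4z²). Then (1−2z)·(2(1−s)z² + Q(z))·S = z²·(Q(z) − (1−s)(1−2z)) in ℤ[[s,z]]. (This is the power-series form of Σ_λ s^{ds(λ)} z^{sp(λ)} = 1 + z²(√(1−4z²) − (1−s)(1−2z)) / ((1−2z)(2(1−s)z² + √(1−4z²))), the sum being over nonempty partitions.) -/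

import Mathlib

/-- A partition fitting in the `n × n` square, encoded as its zero-padded part sequence:
an antitone function `f : Fin n → ℕ` with all values at most `n`. -/
def IsBoxPartition (n : ℕ) (f : Fin n → ℕ) : Prop :=
  Antitone f ∧ ∀ i, f i ≤ n

/-- `conjAt n f i = λ'_i = #{j : λ_j ≥ i}` (for `i ≥ 1`), computed inside the box. -/
def conjAt (n : ℕ) (f : Fin n → ℕ) (i : ℕ) : ℕ :=
  (Finset.univ.filter fun j : Fin n => i ≤ f j).card

/-- The degree of symmetry of the (unpadded) partition encoded by `f`:
`ds(λ) = #{i ∈ {1,…,ℓ} : λ_i = λ'_i}`, where `ℓ` is the number of (nonzero) parts. -/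
def dsPart (n : ℕ) (f : Fin n → ℕ) : ℕ :=
  (Finset.univ.filter fun i : Fin n => 1 ≤ f i ∧ f i = conjAt n f (i.val + 1)).card

/-- The series `S ∈ ℤ[[s,z]]` whose coefficient of `s^k z^n` is the number of nonempty
partitions with semiperimeter `sp(λ) = λ_1 + λ'_1 = n` and `ds(λ) = k`. A nonempty
partition with semiperimeter `n` fits in the `n × n` square; `λ_1 = Finset.univ.sup f`
and `λ'_1 = conjAt _ f 1`. Variable `0` is `s`, variable `1` is `z`. -/
noncomputable def S : MvPowerSeries (Fin 2) ℤ := fun d =>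
  ({f : Fin (d 1) → ℕ | IsBoxPartition (d 1) f ∧ 1 ≤ conjAt (d 1) f 1 ∧
      Finset.univ.sup f + conjAt (d 1) f 1 = d 1 ∧ dsPart (d 1) f = d 0}.ncard : ℤ)

/-- `C(z²) = Σ_{m≥0} Cat_m z^{2m}`, viewed in `ℤ[[s,z]]`. -/
noncomputable def C2 : MvPowerSeries (Fin 2) ℤ := fun d =>
  if d 0 = 0 ∧ Even (d 1) then (catalan (d 1 / 2) : ℤ) else 0

/-- `Q(z) = 1 − 2z²C(z²)`, the power-series square root of `1 − 4z²`. -/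
noncomputable def Q : MvPowerSeries (Fin 2) ℤ :=
  1 - 2 * (MvPowerSeries.X 1) ^ 2 * C2

/-! ### Words and their suffix heights -/

/-- Height function of a word: `hf u t` is one plus the number of `true` in the suffix from `t`. -/
def hf : List Bool → ℕ → ℕ
  | [], 0 => 1
  | [], _ + 1 => 0
  | x :: u, 0 => hf u 0 + x.toNat
  | _ :: u, t + 1 => hf u t

/-- Number of common steps. -/
def com : List Bool → List Bool → ℕ
  | [], [] => 1
  | x :: u, y :: v => (if hf (x :: u) 0 = hf (y :: v) 0 ∧ x = y then 1 else 0) + com u v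
  | [], _ :: _ => 0
  | _ :: _, [] => 0

/-- All words of length `n`. -/
def words : ℕ → Finset (List Bool)
  | 0 => {[]}
  | n + 1 => (words n).image (List.cons true) ∪ (words n).image (List.cons false)

theorem mem_words (n : ℕ) (u : List Bool) : u ∈ words n ↔ u.length = n := by
  induction n generalizing u with
  | zero => simp [words]
  | succ n ih =>
    cases u with
    | nil => simp [words]
    | cons x u => cases x <;> simp [words, ih]

theorem sum_words {M : Type*} [AddCommMonoid M] (n : ℕ) (F : List Bool → M) :
    ∑ u ∈ words (n + 1), F u = ∑ u ∈ words n, (F (true :: u) + F (false :: u)) := by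
  rw [words, Finset.sum_union, Finset.sum_image, Finset.sum_image, Finset.sum_add_distrib]
  · intro a _ b _ h; simpa using h
  · intro a _ b _ h; simpa using h
  · rw [Finset.disjoint_left]
    intro a h1 h2
    simp only [Finset.mem_image] at h1 h2
    obtain ⟨b, -, rfl⟩ := h1
    obtain ⟨c, -, h⟩ := h2
    simp at h

theorem hf_pos (u : List Bool) : 1 ≤ hf u 0 := by
  induction u with
  | nil => simp [hf]
  | cons x u ih => simp only [hf]; omega

theorem hf_eq_zero (u : List Bool) (t : ℕ) : hf u t = 0 ↔ u.length + 1 ≤ t := by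
  induction u generalizing t with
  | nil => cases t <;> simp [hf]
  | cons x u ih =>
    cases t with
    | zero => have := hf_pos u; simp only [hf, List.length_cons]; omega
    | succ t => simp [hf, ih]

theorem hf_slow (u : List Bool) (t : ℕ) : hf u (t + 1) ≤ hf u t ∧ hf u t ≤ hf u (t + 1) + 1 := by
  induction u generalizing t with
  | nil => cases t <;> simp [hf]
  | cons x u ih =>
    cases t with
    | zero => cases x <;> simp [hf]
    | succ t => simpa [hf] using ih t

theorem hf_inj (u v : List Bool) (h : ∀ t, hf u t = hf v t) : u = v := by
  induction u generalizing v with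
  | nil =>
    cases v with
    | nil => rfl
    | cons y v =>
      have := h 1
      have h2 := hf_pos v
      simp [hf] at this; omega
  | cons x u ih =>
    cases v with
    | nil =>
      have := h 1
      have h2 := hf_pos u
      simp [hf] at this; omega
    | cons y v =>
      have h1 : u = v := ih v (fun t => by simpa [hf] using h (t + 1))
      subst h1
      have := h 0
      cases x <;> cases y <;> simp_all [hf]

theorem hf_surj (a : ℕ) (h : ℕ → ℕ) (hs : ∀ t, h (t + 1) ≤ h t ∧ h t ≤ h (t + 1) + 1)
    (hz : ∀ t, h t = 0 ↔ a + 1 ≤ t) : ∃ u : List Bool, u.length = a ∧ ∀ t, hf u t = h t := by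
  induction a generalizing h with
  | zero =>
    refine ⟨[], rfl, fun t => ?_⟩
    cases t with
    | zero =>
      have h1 := hs 0; have h2 := hz 0; have h3 := hz 1
      simp only [hf]; simp at h2 h3 h1; omega
    | succ t => simp only [hf]; exact ((hz (t + 1)).2 (by omega)).symm
  | succ a ih =>
    obtain ⟨u, hu, hu2⟩ := ih (fun t => h (t + 1)) (fun t => hs (t + 1))
      (fun t => by rw [hz]; omega)
    refine ⟨decide (h 0 ≠ h 1) :: u, by simp [hu], fun t => ?_⟩
    cases t with
    | zero =>
      have h1 := hs 0
      simp only [hf, hu2]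
      by_cases h2 : h 0 = h 1
      · simp [h2]
      · simp [h2]; simp at h1; omega
    | succ t => simp only [hf, hu2]

theorem com_eq (u v : List Bool) (N : ℕ) (hN : u.length < N) :
    com u v = ∑ t ∈ Finset.range N,
      if hf u t ≠ 0 ∧ hf u t = hf v t ∧ hf u (t + 1) = hf v (t + 1) then 1 else 0 := by
  induction u generalizing v N with
  | nil =>
    obtain ⟨N, rfl⟩ : ∃ M, N = M + 1 := ⟨N - 1, by simp at hN; omega⟩
    rw [Finset.sum_range_succ']
    cases v with
    | nil => simp [com, hf]
    | cons y v => have := hf_pos v; simp [com, hf]; omega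
  | cons x u ih =>
    obtain ⟨N, rfl⟩ : ∃ M, N = M + 1 := ⟨N - 1, by simp at hN; omega⟩
    rw [Finset.sum_range_succ']
    cases v with
    | nil =>
      have h1 := hf_pos u
      symm
      simp only [com]
      rw [Nat.add_eq_zero_iff]
      constructor
      · apply Finset.sum_eq_zero
        intro t _
        rw [if_neg]
        rintro ⟨h2, h3, h4⟩
        simp [hf] at h3 h2
        exact h2 h3
      · rw [if_neg]
        rintro ⟨h2, h3, h4⟩
        simp [hf] at h4
        omega
    | cons y v =>
      rw [com, ih v N (by simpa using hN), add_comm]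
      congr 1
      have h1 := hf_pos u
      congr 1
      apply propext
      simp only [hf]
      cases x <;> cases y <;> simp <;> omega

/-! ### The refined counts -/

open Polynomial in
/-- Refined count with offset `δ`. -/
noncomputable def WW (s : ℤ[X]) (a b : ℕ) (δ : ℤ) : ℤ[X] :=
  ∑ u ∈ words a, ∑ v ∈ words b, if (hf u 0 : ℤ) = hf v 0 + δ then s ^ com u v else 0

open Polynomial in
theorem WW_succ (s : ℤ[X]) (a b : ℕ) (δ : ℤ) :
    WW s (a + 1) (b + 1) δ = WW s a b (δ + 1) + WW s a b (δ - 1)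
      + 2 * (if δ = 0 then s else 1) * WW s a b δ := by
  simp only [WW, sum_words, Finset.mul_sum, ← Finset.sum_add_distrib]
  refine Finset.sum_congr rfl fun u _ => Finset.sum_congr rfl fun v _ => ?_
  simp only [com, hf, Bool.toNat_true, Bool.toNat_false]
  have e1 : ((hf u 0 + 1 : ℕ) : ℤ) = (hf v 0 + 1 : ℕ) + δ ↔ (hf u 0 : ℤ) = hf v 0 + δ := by
    push_cast; constructor <;> intro h <;> linarith
  have e2 : ((hf u 0 + 1 : ℕ) : ℤ) = (hf v 0 + 0 : ℕ) + δ ↔ (hf u 0 : ℤ) = hf v 0 + (δ - 1) := by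
    push_cast; constructor <;> intro h <;> linarith
  have e3 : ((hf u 0 + 0 : ℕ) : ℤ) = (hf v 0 + 1 : ℕ) + δ ↔ (hf u 0 : ℤ) = hf v 0 + (δ + 1) := by
    push_cast; constructor <;> intro h <;> linarith
  have e4 : ((hf u 0 + 0 : ℕ) : ℤ) = (hf v 0 + 0 : ℕ) + δ ↔ (hf u 0 : ℤ) = hf v 0 + δ := by
    push_cast; constructor <;> intro h <;> linarith
  simp only [e1, e2, e3, e4]
  by_cases h : (hf u 0 : ℤ) = hf v 0 + δ
  · have h5 : ¬ ((hf u 0 : ℤ) = hf v 0 + (δ - 1)) := by omega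
    have h6 : ¬ ((hf u 0 : ℤ) = hf v 0 + (δ + 1)) := by omega
    by_cases hd : δ = 0
    · have h7 : hf u 0 = hf v 0 := by omega
      simp [hd, h7, pow_add]; ring
    · have h7 : hf u 0 ≠ hf v 0 := by omega
      simp [hd, h7, h]; ring
  · simp [h]; ring

theorem com_nil (v : List Bool) (b : ℕ) (hv : v ∈ words (b + 1)) : com [] v = 0 := by
  rw [mem_words] at hv
  cases v with
  | nil => simp at hv
  | cons y v => rfl

theorem com_nil' (v : List Bool) (b : ℕ) (hv : v ∈ words (b + 1)) : com v [] = 0 := by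
  rw [mem_words] at hv
  cases v with
  | nil => simp at hv
  | cons y v => rfl

open Polynomial in
theorem WW_zero_succ (s : ℤ[X]) (b : ℕ) (δ : ℤ) : WW s 0 (b + 1) δ = WW 1 0 (b + 1) δ := by
  simp only [WW]
  refine Finset.sum_congr rfl fun u hu => Finset.sum_congr rfl fun v hv => ?_
  simp only [words, Finset.mem_singleton] at hu
  subst hu
  rw [com_nil v b hv]; simp

open Polynomial in
theorem WW_succ_zero (s : ℤ[X]) (b : ℕ) (δ : ℤ) : WW s (b + 1) 0 δ = WW 1 (b + 1) 0 δ := by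
  simp only [WW]
  refine Finset.sum_congr rfl fun u hu => Finset.sum_congr rfl fun v hv => ?_
  simp only [words, Finset.mem_singleton] at hv
  subst hv
  rw [com_nil' u b hu]; simp

open Polynomial in
theorem WW_zero_zero (s : ℤ[X]) (δ : ℤ) : WW s 0 0 δ = if δ = 0 then s else 0 := by
  simp [WW, words, hf, com]

/-- Integer-indexed binomial coefficient. -/
def ch (n : ℕ) (k : ℤ) : ℕ := if k < 0 then 0 else n.choose k.toNat

theorem ch_succ (n : ℕ) (k : ℤ) : ch (n + 1) k = ch n k + ch n (k - 1) := by
  simp only [ch]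
  rcases lt_trichotomy k 0 with h | h | h
  · rw [if_pos h, if_pos h, if_pos (by omega)]
  · subst h; simp
  · rw [if_neg (by omega), if_neg (by omega), if_neg (by omega)]
    obtain ⟨m, rfl⟩ : ∃ m : ℕ, k = m + 1 := ⟨(k - 1).toNat, by omega⟩
    have e1 : ((m : ℤ) + 1).toNat = m + 1 := by omega
    have e2 : ((m : ℤ) + 1 - 1).toNat = m := by omega
    rw [e1, e2, Nat.choose_succ_succ']; omega

open Polynomial in
theorem WW_one_left (a b : ℕ) (δ : ℤ) :
    WW 1 (a + 1) b δ = WW 1 a b δ + WW 1 a b (δ - 1) := by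
  simp only [WW, sum_words, ← Finset.sum_add_distrib, one_pow]
  refine Finset.sum_congr rfl fun u _ => Finset.sum_congr rfl fun v _ => ?_
  simp only [hf, Bool.toNat_true, Bool.toNat_false]
  rw [add_comm]
  congr 1
  congr 1
  apply propext; push_cast
  constructor <;> intro h <;> linarith

open Polynomial in
theorem WW_one_right (b : ℕ) (δ : ℤ) :
    WW 1 0 (b + 1) δ = WW 1 0 b δ + WW 1 0 b (δ + 1) := by
  simp only [WW, sum_words, ← Finset.sum_add_distrib, one_pow]
  refine Finset.sum_congr rfl fun u _ => Finset.sum_congr rfl fun v _ => ?_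
  simp only [hf, Bool.toNat_true, Bool.toNat_false]
  rw [add_comm]
  congr 1
  congr 1
  apply propext; push_cast
  constructor <;> intro h <;> linarith

theorem WW_one (a b : ℕ) (δ : ℤ) : WW 1 a b δ = (ch (a + b) (b + δ) : ℕ) := by
  induction a generalizing δ with
  | zero =>
    induction b generalizing δ with
    | zero =>
      rw [WW_zero_zero, ch]
      rcases lt_trichotomy δ 0 with h | h | h
      · rw [if_neg (by omega), if_pos (by omega)]; simp
      · subst h; simp
      · rw [if_neg (by omega), if_neg (by omega)]
        rw [Nat.choose_eq_zero_of_lt (by omega)]; simp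
    | succ b ih =>
      rw [WW_one_right, ih, ih, ← Nat.cast_add]
      congr 1
      have e : 0 + (b + 1) = (0 + b) + 1 := by omega
      rw [e, ch_succ]
      have e1 : ((b + 1 : ℕ) : ℤ) + δ = b + (δ + 1) := by push_cast; ring
      have e2 : (b : ℤ) + (δ + 1) - 1 = b + δ := by ring
      rw [e1, e2, add_comm]
  | succ a ih =>
    rw [WW_one_left, ih, ih, ← Nat.cast_add]
    congr 1
    have e : a + 1 + b = (a + b) + 1 := by omega
    rw [e, ch_succ]
    have e2 : (b : ℤ) + δ - 1 = b + (δ - 1) := by ring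
    rw [e2]

open Polynomial in
/-- Total count in total length `n`. -/
noncomputable def wn (s : ℤ[X]) (n : ℕ) (δ : ℤ) : ℤ[X] :=
  ∑ p ∈ Finset.HasAntidiagonal.antidiagonal n, WW s p.1 p.2 δ

theorem wn_one (n : ℕ) : wn 1 n 0 = 2 ^ n := by
  simp only [wn, WW_one]
  rw [← Nat.cast_sum]
  have : ∑ p ∈ Finset.HasAntidiagonal.antidiagonal n, ch (p.1 + p.2) ((p.2 : ℤ) + 0) = 2 ^ n := by
    rw [← Nat.sum_range_choose, ← Finset.Nat.sum_antidiagonal_eq_sum_range_succ_mk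
      (fun p : ℕ × ℕ => n.choose p.1), ← Finset.Nat.sum_antidiagonal_swap]
    refine Finset.sum_congr rfl fun p hp => ?_
    rw [Finset.HasAntidiagonal.mem_antidiagonal] at hp
    simp [ch, hp, add_comm]
  rw [this]; simp

open Polynomial in
theorem wn_rec (s : ℤ[X]) (n : ℕ) (δ : ℤ) :
    wn s (n + 2) δ - wn 1 (n + 2) δ =
      (wn s n (δ + 1) - wn 1 n (δ + 1)) + 2 * (wn s n δ - wn 1 n δ)
        + (wn s n (δ - 1) - wn 1 n (δ - 1)) + if δ = 0 then 2 * (s - 1) * wn s n δ else 0 := by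
  have key : ∀ s : ℤ[X], wn s (n + 2) δ = WW s 0 (n + 2) δ + WW s (n + 2) 0 δ
      + (wn s n (δ + 1) + wn s n (δ - 1) + 2 * (if δ = 0 then s else 1) * wn s n δ) := by
    intro s
    simp only [wn]
    rw [Finset.Nat.antidiagonal_succ_succ']
    simp only [Finset.sum_cons, Finset.sum_map, Finset.mul_sum, ← Finset.sum_add_distrib]
    simp only [Function.Embedding.prodMap, Function.Embedding.coeFn_mk, Prod.map,
      Nat.succ_eq_add_one, WW_succ]
    ring
  rw [key s, key 1, WW_zero_succ s, WW_succ_zero s]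
  split_ifs <;> ring

open Polynomial in
theorem wn_zero (s : ℤ[X]) (δ : ℤ) : wn s 0 δ - wn 1 0 δ = if δ = 0 then s - 1 else 0 := by
  simp only [wn, Finset.Nat.antidiagonal_zero, Finset.sum_singleton, WW_zero_zero]
  split_ifs <;> simp

open Polynomial in
theorem wn_onee (s : ℤ[X]) (δ : ℤ) : wn s 1 δ - wn 1 1 δ = 0 := by
  have h : ∀ s : ℤ[X], wn s 1 δ = WW s 0 1 δ + WW s 1 0 δ := by
    intro s; simp [wn, Finset.Nat.antidiagonal_succ]
  rw [h s, h 1, WW_zero_succ s 0, WW_succ_zero s 0, sub_self]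

/-! ### The power series identity over `ℤ[s]` -/

open Polynomial in
theorem hom_zero (Y : ℤ → PowerSeries ℤ[X])
    (h : ∀ δ, Y δ = PowerSeries.X ^ 2 * (Y (δ + 1) + 2 * Y δ + Y (δ - 1))) (δ : ℤ) : Y δ = 0 := by
  have key : ∀ n δ, PowerSeries.coeff n (Y δ) = 0 := by
    intro n
    induction n using Nat.strong_induction_on with
    | _ n ih =>
      intro δ
      rw [h δ, PowerSeries.coeff_X_pow_mul']
      split_ifs with h2
      · have h3 : n - 2 < n := by omega
        have e : (2 : PowerSeries ℤ[X]) * Y δ = Y δ + Y δ := by ring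
        rw [e]
        simp only [map_add, ih _ h3, add_zero]
      · rfl
  ext1 n
  rw [key]; simp

open Polynomial in
/-- `C(z²)` over `ℤ[s]`. -/
noncomputable def cs : PowerSeries ℤ[X] :=
  PowerSeries.mk fun n => if Even n then (catalan (n / 2) : ℤ[X]) else 0

open Polynomial in
/-- The generating function of refined counts with offset `δ`. -/
noncomputable def ws (s : ℤ[X]) (δ : ℤ) : PowerSeries ℤ[X] := PowerSeries.mk fun n => wn s n δ

theorem cs_eq : cs = 1 + PowerSeries.X ^ 2 * cs ^ 2 := by
  let c0 : PowerSeries (Polynomial ℤ) :=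
    PowerSeries.map (Nat.castRingHom (Polynomial ℤ)) PowerSeries.catalanSeries
  have h0 : c0 ^ 2 * PowerSeries.X + 1 = c0 := by
    have := congrArg (PowerSeries.map (Nat.castRingHom (Polynomial ℤ)))
      PowerSeries.catalanSeries_sq_mul_X_add_one
    simpa [c0] using this
  have h1 : cs = PowerSeries.expand 2 (by norm_num) c0 := by
    ext1 n
    rw [PowerSeries.coeff_expand, cs, PowerSeries.coeff_mk]
    simp only [even_iff_two_dvd, c0, PowerSeries.coeff_map, PowerSeries.catalanSeries_coeff]
    rfl
  have h2 := congrArg (PowerSeries.expand 2 (by norm_num)) h0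
  simp only [map_add, map_mul, map_pow, map_one, PowerSeries.expand_X, ← h1] at h2
  rw [← h2]
  rw [h2]; linear_combination -h2

open Polynomial in
theorem ws_rec (s : ℤ[X]) (δ : ℤ) :
    ws s δ - ws 1 δ = PowerSeries.X ^ 2 * ((ws s (δ + 1) - ws 1 (δ + 1)) + 2 * (ws s δ - ws 1 δ)
      + (ws s (δ - 1) - ws 1 (δ - 1)))
      + if δ = 0 then PowerSeries.C (s - 1) * (1 + 2 * PowerSeries.X ^ 2 * ws s 0) else 0 := by
  have e : ∀ c : PowerSeries ℤ[X], 2 * c = PowerSeries.C 2 * c := by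
    intro c; congr 1
  ext1 n
  have e3 : PowerSeries.C (s - 1) * (1 + 2 * PowerSeries.X ^ 2 * ws s 0)
    = PowerSeries.C (s - 1) + PowerSeries.X ^ 2 * (PowerSeries.C (2 * (s - 1)) * ws s 0) := by
    rw [map_mul]
    have : PowerSeries.C (2 : ℤ[X]) = 2 := rfl
    rw [this]; ring
  rw [e3, e]
  match n with
  | 0 =>
    have := wn_zero s δ
    split_ifs with h <;> simp [PowerSeries.coeff_X_pow_mul', ws, this, h] <;> simpa [h] using this
  | 1 =>
    have := wn_onee s δ
    split_ifs with h <;> simp [PowerSeries.coeff_X_pow_mul', PowerSeries.coeff_C, ws, h] <;>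
      simpa [h] using this
  | n + 2 =>
    have := wn_rec s n δ
    split_ifs with h
    · subst h
      have e4 : PowerSeries.coeff (n + 2) (PowerSeries.X ^ 2 * (PowerSeries.C (2 * (s - 1)) * ws s 0))
          = 2 * (s - 1) * wn s n 0 := by
        rw [PowerSeries.coeff_X_pow_mul', if_pos (by omega), PowerSeries.coeff_C_mul]
        simp [ws]
      rw [map_add, map_add (PowerSeries.coeff (n + 2)) (PowerSeries.C (s - 1)), e4]
      simp [PowerSeries.coeff_X_pow_mul', PowerSeries.coeff_C_mul, ws] at this ⊢
      rw [this]
    · simp [PowerSeries.coeff_X_pow_mul', PowerSeries.coeff_C_mul, ws, h] at this ⊢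
      rw [this]

open Polynomial in
theorem ws_key (s : ℤ[X]) :
    (1 - 2 * PowerSeries.X ^ 2 * cs) * (ws s 0 - ws 1 0)
      = PowerSeries.C (s - 1) * (1 + 2 * PowerSeries.X ^ 2 * ws s 0) := by
  set E := PowerSeries.C (s - 1) * (1 + 2 * PowerSeries.X ^ 2 * ws s 0) with hE
  have hc := cs_eq
  set r := cs - 1 with hr
  have hr2 : r = PowerSeries.X ^ 2 * (1 + r) ^ 2 := by
    rw [hr]; linear_combination hc
  have := hom_zero (fun δ => (1 - 2 * PowerSeries.X ^ 2 * cs) * (ws s δ - ws 1 δ)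
    - r ^ δ.natAbs * E) (by
      intro δ
      have h := ws_rec s δ
      rcases lt_trichotomy δ 0 with h1 | h1 | h1
      · obtain ⟨m, rfl⟩ : ∃ m : ℕ, δ = -(m + 1 : ℤ) := ⟨(-δ - 1).toNat, by omega⟩
        have e1 : (-(m + 1 : ℤ)).natAbs = m + 1 := by omega
        have e2 : (-(m + 1 : ℤ) + 1).natAbs = m := by omega
        have e3 : (-(m + 1 : ℤ) - 1).natAbs = m + 2 := by omega
        rw [if_neg (by omega)] at h
        simp only [e1, e2, e3]
        linear_combination (1 - 2 * PowerSeries.X ^ 2 * cs) * h - r ^ m * E * hr2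
      · subst h1
        rw [if_pos rfl] at h
        have e2 : ((0 : ℤ) + 1).natAbs = 1 := by omega
        have e3 : ((0 : ℤ) - 1).natAbs = 1 := by omega
        simp only [e2, e3, Int.natAbs_zero]
        rw [← hE] at h
        linear_combination (1 - 2 * PowerSeries.X ^ 2 * cs) * h
          + (2 * PowerSeries.X ^ 2 * E) * hr
      · obtain ⟨m, rfl⟩ : ∃ m : ℕ, δ = (m + 1 : ℤ) := ⟨(δ - 1).toNat, by omega⟩
        have e1 : ((m + 1 : ℤ)).natAbs = m + 1 := by omega
        have e2 : ((m + 1 : ℤ) + 1).natAbs = m + 2 := by omega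
        have e3 : ((m + 1 : ℤ) - 1).natAbs = m := by omega
        rw [if_neg (by omega)] at h
        simp only [e1, e2, e3]
        linear_combination (1 - 2 * PowerSeries.X ^ 2 * cs) * h - r ^ m * E * hr2) 0
  simp only [Int.natAbs_zero, pow_zero, one_mul] at this
  exact sub_eq_zero.1 this

theorem ws_one : (1 - 2 * PowerSeries.X) * ws 1 0 = 1 := by
  ext1 n
  have : ((1 : PowerSeries (Polynomial ℤ)) - 2 * PowerSeries.X) * ws 1 0
    = ws 1 0 - PowerSeries.X * (PowerSeries.C 2 * ws 1 0) := by
    have : PowerSeries.C (2 : Polynomial ℤ) = 2 := rfl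
    rw [this]; ring
  rw [this]
  cases n with
  | zero => simp [ws, wn_one]
  | succ n =>
    simp [ws, wn_one, PowerSeries.coeff_succ_X_mul, PowerSeries.coeff_C_mul, PowerSeries.coeff_one]
    ring

open Polynomial in
theorem final_ps (s : ℤ[X]) :
    (1 - 2 * PowerSeries.X) * (2 * (1 - PowerSeries.C s) * PowerSeries.X ^ 2
      + (1 - 2 * PowerSeries.X ^ 2 * cs)) * (PowerSeries.X ^ 2 * ws s 0)
    = PowerSeries.X ^ 2 * ((1 - 2 * PowerSeries.X ^ 2 * cs)
      - (1 - PowerSeries.C s) * (1 - 2 * PowerSeries.X)) := by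
  have h1 := ws_key s
  have h2 := ws_one
  rw [map_sub, map_one] at h1
  linear_combination PowerSeries.X ^ 2 * (1 - 2 * PowerSeries.X) * h1
    + PowerSeries.X ^ 2 * (1 - 2 * PowerSeries.X ^ 2 * cs) * h2

/-! ### Transfer to two-variable power series -/

open Polynomial in
/-- Coefficient transfer. -/
noncomputable def Phi (p : PowerSeries ℤ[X]) : MvPowerSeries (Fin 2) ℤ :=
  fun d => (PowerSeries.coeff (d 1) p).coeff (d 0)

open Polynomial in
theorem coeff_Phi (p : PowerSeries ℤ[X]) (d : Fin 2 →₀ ℕ) :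
    MvPowerSeries.coeff d (Phi p) = (PowerSeries.coeff (d 1) p).coeff (d 0) := rfl

open Polynomial in
theorem Phi_mul (p q : PowerSeries ℤ[X]) : Phi (p * q) = Phi p * Phi q := by
  classical
  ext d
  rw [coeff_Phi, PowerSeries.coeff_mul, MvPowerSeries.coeff_mul, Polynomial.finsetSum_coeff]
  simp only [Polynomial.coeff_mul, coeff_Phi]
  rw [Finset.sum_sigma']
  refine Finset.sum_bij' (fun x _ => (Finsupp.single 0 x.2.1 + Finsupp.single 1 x.1.1,
      Finsupp.single 0 x.2.2 + Finsupp.single 1 x.1.2))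
    (fun y _ => ⟨(y.1 1, y.2 1), (y.1 0, y.2 0)⟩) ?_ ?_ ?_ ?_ ?_
  · rintro ⟨⟨a, b⟩, ⟨c, e⟩⟩ h
    simp only [Finset.mem_sigma, Finset.HasAntidiagonal.mem_antidiagonal] at h ⊢
    ext i
    fin_cases i <;> simp [h.1, h.2]
  · rintro ⟨y1, y2⟩ h
    simp only [Finset.mem_sigma, Finset.HasAntidiagonal.mem_antidiagonal] at h ⊢
    subst h
    simp
  · rintro ⟨⟨a, b⟩, ⟨c, e⟩⟩ h
    simp
  · rintro ⟨y1, y2⟩ h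
    ext i <;> fin_cases i <;> simp
  · rintro ⟨⟨a, b⟩, ⟨c, e⟩⟩ h
    simp

open Polynomial in
theorem Phi_add (p q : PowerSeries ℤ[X]) : Phi (p + q) = Phi p + Phi q := by
  ext d; simp [coeff_Phi]

theorem Phi_one : Phi 1 = 1 := by
  classical
  ext d
  rw [coeff_Phi, PowerSeries.coeff_one, MvPowerSeries.coeff_one]
  by_cases h : d = 0
  · simp [h]
  · rw [if_neg h]
    split_ifs with h1
    · rw [Polynomial.coeff_one, if_neg]
      intro h2
      apply h; ext i; fin_cases i <;> simp [h1, h2]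
    · simp

open Polynomial in
/-- `Phi` as a ring homomorphism. -/
noncomputable def PhiHom : PowerSeries ℤ[X] →+* MvPowerSeries (Fin 2) ℤ where
  toFun := Phi
  map_one' := Phi_one
  map_mul' := Phi_mul
  map_zero' := by ext d; simp [coeff_Phi]
  map_add' := Phi_add

theorem Phi_X : PhiHom PowerSeries.X = MvPowerSeries.X 1 := by
  classical
  ext d
  change MvPowerSeries.coeff d (Phi _) = _
  rw [coeff_Phi, PowerSeries.coeff_X, MvPowerSeries.coeff_X]
  by_cases h : d = Finsupp.single 1 1
  · simp [h]
  · rw [if_neg h]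
    split_ifs with h1
    · rw [Polynomial.coeff_one, if_neg]
      intro h2
      apply h; ext i; fin_cases i <;> simp [h1, h2]
    · simp

theorem Phi_C : PhiHom (PowerSeries.C Polynomial.X) = MvPowerSeries.X 0 := by
  classical
  ext d
  change MvPowerSeries.coeff d (Phi _) = _
  rw [coeff_Phi, PowerSeries.coeff_C, MvPowerSeries.coeff_X]
  by_cases h : d = Finsupp.single 0 1
  · simp [h]
  · rw [if_neg h]
    split_ifs with h1
    · rw [Polynomial.coeff_X, if_neg]
      intro h2
      apply h; ext i; fin_cases i <;> simp [h1, ← h2]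
    · simp

theorem Phi_cs : PhiHom cs = C2 := by
  ext d
  change (PowerSeries.coeff (d 1) cs).coeff (d 0) = C2 d
  rw [C2, cs, PowerSeries.coeff_mk]
  by_cases h1 : Even (d 1)
  · rw [if_pos h1]
    by_cases h0 : d 0 = 0 <;> simp [h0, h1, Polynomial.coeff_natCast_ite]
  · simp [h1]

theorem Phi_Q : PhiHom (1 - 2 * PowerSeries.X ^ 2 * cs) = Q := by
  rw [Q, map_sub, map_mul, map_mul, map_pow, map_one, Phi_X, Phi_cs, map_ofNat]

/-! ### Partitions and pairs of words -/

/-- Number of `i < n` satisfying `p`. -/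
def cnt (p : ℕ → Prop) [DecidablePred p] (n : ℕ) : ℕ := ((Finset.range n).filter p).card

theorem cnt_lt (p : ℕ → Prop) [DecidablePred p] (n : ℕ) (hp : ∀ i, p (i + 1) → p i)
    (hn : ¬ p n) (j : ℕ) : j < cnt p n ↔ p j := by
  have hd : ∀ k i, p (i + k) → p i := by
    intro k
    induction k with
    | zero => intro i h; exact h
    | succ k ih => intro i h; exact ih i (hp _ h)
  have hd2 : ∀ i i', i ≤ i' → p i' → p i := by
    intro i i' h h2
    obtain ⟨k, rfl⟩ := Nat.exists_eq_add_of_le h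
    exact hd k i h2
  constructor
  · intro h
    by_contra hj
    have : (Finset.range n).filter p ⊆ Finset.range j := by
      intro i hi
      rw [Finset.mem_filter] at hi
      rw [Finset.mem_range]
      by_contra h3
      exact hj (hd2 j i (by omega) hi.2)
    have := Finset.card_le_card this
    rw [Finset.card_range] at this
    unfold cnt at h
    omega
  · intro h
    have : Finset.range (j + 1) ⊆ (Finset.range n).filter p := by
      intro i hi
      rw [Finset.mem_range] at hi
      rw [Finset.mem_filter, Finset.mem_range]
      have hi2 : p i := hd2 i j (by omega) h
      refine ⟨?_, hi2⟩
      by_contra h3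
      exact hn (hd2 n i (by omega) hi2)
    have := Finset.card_le_card this
    rw [Finset.card_range] at this
    unfold cnt
    omega

/-- The degree of symmetry counted through common steps of the two boundary paths. -/
theorem ds_eq (n : ℕ) (F c h g : ℕ → ℕ) (hF : Antitone F) (hF0 : F 0 ≤ n) (hFn : F n = 0)
    (hc : ∀ i j, i < c j ↔ j < F i) (hh : ∀ i t, i < h t ↔ i + t < F i)
    (hg : ∀ j t, j < g t ↔ j < F (j + t)) :
    ((Finset.range n).filter fun i => 1 ≤ F i ∧ F i = c i).card =
      ((Finset.range n).filter fun t => h t ≠ 0 ∧ h t = g t ∧ h (t + 1) = g (t + 1)).card := by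
  have f1 : ∀ i, F i = c i → i < F i → h (F i - i - 1) = i + 1 ∧ g (F i - i - 1) = i + 1
      ∧ h (F i - i - 1 + 1) = i ∧ g (F i - i - 1 + 1) = i := by
    intro i h1 h2
    obtain ⟨t, ht⟩ : ∃ t, F i = i + t + 1 := ⟨F i - i - 1, by omega⟩
    have e : F i - i - 1 = t := by omega
    rw [e]
    have a1 := hh i t
    have a2 := hh (i + 1) t
    have a3 := hh i (t + 1)
    have a4 := hg i t
    have a5 := hg (i + 1) t
    have a6 := hg i (t + 1)
    have b1 := hF (Nat.le_succ i)
    have b2 := hc (i + t) i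
    have b3 := hc (i + 1 + t) i
    have e2 : i + (t + 1) = i + 1 + t := by omega
    simp only [Nat.succ_eq_add_one] at b1
    rw [e2] at a6 a3
    have c3 : i ≤ h (t + 1) ∧ i ≤ g (t + 1) := by
      rcases Nat.eq_zero_or_pos i with hi | hi
      · omega
      · have a7 := hh (i - 1) (t + 1)
        have a8 := hg (i - 1) (t + 1)
        have b4 := hF (Nat.sub_le i 1)
        have e3 : i - 1 + (t + 1) = i + t := by omega
        rw [e3] at a7 a8
        omega
    omega
  have f2 : ∀ i, 1 ≤ F i → F i = c i → F i ≤ i → h (i - F i) = F i ∧ g (i - F i) = F i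
      ∧ h (i - F i + 1) = F i ∧ g (i - F i + 1) = F i := by
    intro i h0 h1 h2
    obtain ⟨m, hm⟩ : ∃ m, F i = m + 1 := ⟨F i - 1, by omega⟩
    obtain ⟨t, rfl⟩ : ∃ t, i = m + 1 + t := ⟨i - (m + 1), by omega⟩
    have e : m + 1 + t - F (m + 1 + t) = t := by omega
    rw [e]
    have a1 := hh m t
    have a2 := hh (m + 1) t
    have a3 := hh m (t + 1)
    have a4 := hh (m + 1) (t + 1)
    have a5 := hg m t
    have a6 := hg (m + 1) t
    have a7 := hg m (t + 1)
    have a8 := hg (m + 1) (t + 1)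
    have b1 := hc m (m + 1 + t)
    have b2 := hc (m + 1) (m + 1 + t)
    have b3 := hF (show m + t ≤ m + 1 + t by omega)
    have b4 := hF (show m + 1 + t ≤ m + 1 + (t + 1) by omega)
    have e2 : m + (t + 1) = m + 1 + t := by omega
    rw [e2] at a3 a7
    omega
  have r1 : ∀ t, h t ≠ 0 → h t = g t → h (t + 1) = g (t + 1) → h (t + 1) < h t →
      F (h t - 1) = h t + t ∧ c (h t - 1) = h t + t := by
    intro t h0 h1 h2 h3
    obtain ⟨k, hk⟩ : ∃ k, h t = k + 1 := ⟨h t - 1, by omega⟩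
    have e : h t - 1 = k := by omega
    rw [e]
    have a1 := hh k t
    have a2 := hh k (t + 1)
    have a3 := hg k t
    have a4 := hg k (t + 1)
    have b1 := hc (k + t) k
    have b2 := hc (k + (t + 1)) k
    omega
  have r2 : ∀ t, h t ≠ 0 → h t = g t → h (t + 1) = g (t + 1) → ¬ h (t + 1) < h t →
      F (h t + t) = h t ∧ c (h t + t) = h t := by
    intro t h0 h1 h2 h3
    obtain ⟨k, hk⟩ : ∃ k, h t = k + 1 := ⟨h t - 1, by omega⟩
    rw [hk]
    have a1 := hh k (t + 1)
    have a2 := hh (k + 1) t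
    have a3 := hg k (t + 1)
    have a4 := hg (k + 1) t
    have b1 := hc k (k + 1 + t)
    have b2 := hc (k + 1) (k + 1 + t)
    have e2 : k + (t + 1) = k + 1 + t := by omega
    rw [e2] at a1 a3
    omega
  have hi : ∀ i, 1 ≤ F i → i < n := by
    intro i h1
    by_contra h2
    have := hF (show n ≤ i by omega)
    omega
  have ht : ∀ t, h t ≠ 0 → t < n := by
    intro t h1
    have := hh 0 t
    rw [zero_add] at this
    omega
  refine Finset.card_nbij' (fun i => if i < F i then F i - i - 1 else i - F i)
    (fun t => if h (t + 1) < h t then h t - 1 else h t + t) ?_ ?_ ?_ ?_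
  · intro i hi0
    simp only [Finset.coe_filter, Finset.mem_range, Set.mem_ofPred_eq] at hi0 ⊢
    obtain ⟨-, h1, h2⟩ := hi0
    by_cases h3 : i < F i
    · have := f1 i h2 h3
      rw [if_pos h3]
      refine ⟨ht _ ?_, ?_, ?_, ?_⟩ <;> omega
    · have := f2 i h1 h2 (by omega)
      rw [if_neg h3]
      refine ⟨ht _ ?_, ?_, ?_, ?_⟩ <;> omega
  · intro t ht0
    simp only [Finset.coe_filter, Finset.mem_range, Set.mem_ofPred_eq] at ht0 ⊢
    obtain ⟨-, h1, h2, h3⟩ := ht0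
    by_cases h4 : h (t + 1) < h t
    · have := r1 t h1 h2 h3 h4
      rw [if_pos h4]
      refine ⟨hi _ ?_, ?_, ?_⟩ <;> omega
    · have := r2 t h1 h2 h3 h4
      rw [if_neg h4]
      refine ⟨hi _ ?_, ?_, ?_⟩ <;> omega
  · intro i hi0
    simp only [Finset.coe_filter, Finset.mem_range, Set.mem_ofPred_eq] at hi0 ⊢
    obtain ⟨-, h1, h2⟩ := hi0
    by_cases h3 : i < F i
    · have := f1 i h2 h3
      rw [if_pos h3, if_pos (by omega)]
      omega
    · have := f2 i h1 h2 (by omega)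
      rw [if_neg h3, if_neg (by omega)]
      omega
  · intro t ht0
    simp only [Finset.coe_filter, Finset.mem_range, Set.mem_ofPred_eq] at ht0 ⊢
    obtain ⟨-, h1, h2, h3⟩ := ht0
    by_cases h4 : h (t + 1) < h t
    · have := r1 t h1 h2 h3 h4
      rw [if_pos h4, if_pos (by omega)]
      omega
    · have := r2 t h1 h2 h3 h4
      rw [if_neg h4, if_neg (by omega)]
      omega

theorem conj_eq (N : ℕ) (F : ℕ → ℕ) (j : ℕ) :
    conjAt N (fun i : Fin N => F i) (j + 1) = cnt (fun i => j < F i) N := by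
  rw [conjAt, cnt, Finset.card_filter, Finset.card_filter, Finset.sum_range]
  rfl

theorem dsPart_eq (N : ℕ) (F : ℕ → ℕ) :
    dsPart N (fun i : Fin N => F i) =
      ((Finset.range N).filter fun i => 1 ≤ F i ∧ F i = cnt (fun k => i < F k) N).card := by
  simp only [dsPart, conj_eq]
  rw [Finset.card_filter, Finset.card_filter, Finset.sum_range]

theorem sup_eq (N : ℕ) (F : ℕ → ℕ) (hF : Antitone F) (hN : 0 < N) :
    Finset.univ.sup (fun i : Fin N => F i) = F 0 := by
  apply le_antisymm
  · exact Finset.sup_le fun i _ => hF (Nat.zero_le _)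
  · exact Finset.le_sup (f := fun i : Fin N => F i) (Finset.mem_univ ⟨0, hN⟩)

theorem box_of (N : ℕ) (F : ℕ → ℕ) (hF : Antitone F) (h0 : F 0 ≤ N) :
    IsBoxPartition N (fun i : Fin N => F i) :=
  ⟨fun _ _ h => hF h, fun _ => (hF (Nat.zero_le _)).trans h0⟩

theorem of_box (N : ℕ) (f : Fin N → ℕ) (hf : IsBoxPartition N f) :
    ∃ F : ℕ → ℕ, Antitone F ∧ F 0 ≤ N ∧ F N = 0 ∧ f = fun i : Fin N => F i := by
  refine ⟨fun i => if h : i < N then f ⟨i, h⟩ else 0, ?_, ?_, by simp, ?_⟩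
  · intro i j hij
    by_cases hj : j < N
    · have hi : i < N := lt_of_le_of_lt hij hj
      simp only [hi, hj, dif_pos]
      exact hf.1 hij
    · simp [hj]
  · by_cases hN : 0 < N
    · simp only [hN, dif_pos]; exact hf.2 _
    · simp [hN]
  · funext i; simp

/-- The partition and the words correspond. -/
def PRel (F : ℕ → ℕ) (u v : List Bool) : Prop :=
  (∀ i t, i < hf u t ↔ i + t < F i) ∧ (∀ j t, j < hf v t ↔ j < F (j + t))

theorem cnt_conj (N : ℕ) (F : ℕ → ℕ) (hF : Antitone F) (hN : F N = 0) (i j : ℕ) :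
    i < cnt (fun k => j < F k) N ↔ j < F i := by
  rw [cnt_lt]
  · intro i h; exact lt_of_lt_of_le h (hF (Nat.le_succ i))
  · omega

theorem PRel.props {N : ℕ} {F : ℕ → ℕ} {u v : List Bool} (h : PRel F u v) (hF : Antitone F)
    (h0 : F 0 ≤ N) (hN : F N = 0) :
    F 0 = u.length + 1 ∧ cnt (fun i => 0 < F i) N = v.length + 1 ∧
      dsPart N (fun i : Fin N => F i) = com u v := by
  obtain ⟨h1, h2⟩ := h
  have e0 : F 0 = u.length + 1 := by
    have a := h1 0 (u.length)
    have b := h1 0 (u.length + 1)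
    have a' := hf_eq_zero u u.length
    have b' := hf_eq_zero u (u.length + 1)
    rw [zero_add] at a b
    omega
  refine ⟨e0, ?_, ?_⟩
  · have a := h2 0 (v.length)
    have b := h2 0 (v.length + 1)
    have a' := hf_eq_zero v v.length
    have b' := hf_eq_zero v (v.length + 1)
    have c := cnt_conj N F hF hN v.length 0
    have d := cnt_conj N F hF hN (v.length + 1) 0
    rw [zero_add] at a b
    omega
  · rw [dsPart_eq, com_eq u v N (by omega),
      ds_eq N F (fun i => cnt (fun k => i < F k) N) (hf u) (hf v) hF h0 hN
        (cnt_conj N F hF hN) h1 h2, Finset.card_filter]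

/-- Cells of the diagram attached to two words. -/
def cell (u v : List Bool) (i j : ℕ) : Prop :=
  if i ≤ j then i < hf u (j - i) else j < hf v (i - j)

instance (u v : List Bool) (i : ℕ) : DecidablePred (cell u v i) := fun j => by
  unfold cell; infer_instance

theorem hf_le (u : List Bool) (t : ℕ) : hf u t ≤ u.length + 1 - t := by
  induction u generalizing t with
  | nil => cases t <;> simp [hf]
  | cons x u ih =>
    cases t with
    | zero => have := ih 0; cases x <;> simp [hf] <;> omega
    | succ t => have := ih t; simp only [hf, List.length_cons]; omega

theorem cell_right (u v : List Bool) (h : hf u 0 = hf v 0) (i j : ℕ) (hc : cell u v i (j + 1)) :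
    cell u v i j := by
  unfold cell at *
  rcases lt_trichotomy i (j + 1) with h1 | h1 | h1
  · rw [if_pos (by omega)] at *
    have := hf_slow u (j - i)
    have e : j + 1 - i = j - i + 1 := by omega
    rw [e] at hc; omega
  · subst h1
    rw [if_pos (by omega)] at hc
    rw [if_neg (by omega)]
    have := hf_slow v 0
    have e : j + 1 - j = 0 + 1 := by omega
    rw [e]
    simp only [Nat.sub_self] at hc
    omega
  · rw [if_neg (by omega)] at *
    have := hf_slow v (i - (j + 1))
    have e : i - j = i - (j + 1) + 1 := by omega
    rw [e]; omega

theorem cell_down (u v : List Bool) (h : hf u 0 = hf v 0) (i j : ℕ) (hc : cell u v (i + 1) j) :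
    cell u v i j := by
  unfold cell at *
  rcases lt_trichotomy i j with h1 | h1 | h1
  · rw [if_pos (by omega)] at *
    have := hf_slow u (j - (i + 1))
    have e : j - i = j - (i + 1) + 1 := by omega
    rw [e]; omega
  · subst h1
    rw [if_neg (by omega)] at hc
    rw [if_pos (by omega)]
    have := hf_slow v 0
    have e : i + 1 - i = 0 + 1 := by omega
    rw [e] at hc
    simp only [Nat.sub_self]
    omega
  · rw [if_neg (by omega)] at *
    have := hf_slow v (i - j)
    have e : i + 1 - j = i - j + 1 := by omega
    rw [e] at hc; omega

/-- The partition attached to two words. -/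
def build (N : ℕ) (u v : List Bool) (i : ℕ) : ℕ := cnt (cell u v i) N

theorem build_lt (N : ℕ) (u v : List Bool) (h : hf u 0 = hf v 0)
    (hl : u.length + v.length + 2 = N) (i j : ℕ) : j < build N u v i ↔ cell u v i j := by
  rw [build, cnt_lt]
  · exact fun j => cell_right u v h i j
  · unfold cell
    have a := hf_le u (N - i)
    have b := hf_le v (i - N)
    split_ifs <;> omega

theorem build_props (N : ℕ) (u v : List Bool) (h : hf u 0 = hf v 0)
    (hl : u.length + v.length + 2 = N) :
    Antitone (build N u v) ∧ build N u v 0 ≤ N ∧ build N u v N = 0 ∧ PRel (build N u v) u v := by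
  have hb := build_lt N u v h hl
  refine ⟨?_, ?_, ?_, ?_, ?_⟩
  · apply antitone_nat_of_succ_le
    intro i
    by_contra hi
    have := (hb (i + 1) (build N u v i)).1 (by omega)
    have := (hb i (build N u v i)).2 (cell_down u v h _ _ this)
    omega
  · unfold build cnt
    exact (Finset.card_filter_le _ _).trans (by simp)
  · by_contra h1
    have := (hb N 0).1 (by omega)
    unfold cell at this
    rw [if_neg (by omega)] at this
    have b := hf_le v (N - 0)
    omega
  · intro i t
    rw [hb, cell, if_pos (by omega)]
    simp
  · intro j t
    rw [hb, cell]
    rcases Nat.eq_zero_or_pos t with h1 | h1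
    · subst h1; simp [h]
    · rw [if_neg (by omega)]
      simp

theorem PRel.h0 {F : ℕ → ℕ} {u v : List Bool} (h : PRel F u v) : hf u 0 = hf v 0 := by
  have h1 := h.1 (hf u 0) 0
  have h2 := h.2 (hf u 0) 0
  have h3 := h.1 (hf v 0) 0
  have h4 := h.2 (hf v 0) 0
  simp only [add_zero] at h1 h2 h3 h4
  omega

theorem PRel.uniq {F : ℕ → ℕ} {u v u' v' : List Bool} (h : PRel F u v) (h' : PRel F u' v') :
    u = u' ∧ v = v' := by
  constructor
  · apply hf_inj
    intro t
    have h1 := h.1 (hf u t) t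
    have h2 := h'.1 (hf u t) t
    have h3 := h.1 (hf u' t) t
    have h4 := h'.1 (hf u' t) t
    omega
  · apply hf_inj
    intro t
    have h1 := h.2 (hf v t) t
    have h2 := h'.2 (hf v t) t
    have h3 := h.2 (hf v' t) t
    have h4 := h'.2 (hf v' t) t
    omega

theorem PRel.cell_iff {F : ℕ → ℕ} {u v : List Bool} (h : PRel F u v) (i j : ℕ) :
    j < F i ↔ cell u v i j := by
  unfold cell
  split_ifs with h1
  · have := h.1 i (j - i)
    have e : i + (j - i) = j := by omega
    rw [e] at this
    exact this.symm
  · have := h.2 j (i - j)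
    have e : j + (i - j) = i := by omega
    rw [e] at this
    exact this.symm

theorem PRel.exists (N : ℕ) (F : ℕ → ℕ) (hF : Antitone F) (h0 : F 0 ≤ N) (hN : F N = 0)
    (hp : 1 ≤ F 0) : ∃ u v, PRel F u v := by
  have hstep : ∀ i, F (i + 1) ≤ F i := fun i => hF (Nat.le_succ i)
  have hh : ∀ t i, i < cnt (fun i => i + t < F i) N ↔ i + t < F i := by
    intro t i
    rw [cnt_lt]
    · intro i h; have := hstep i; omega
    · omega
  have hg : ∀ t j, j < cnt (fun j => j < F (j + t)) N ↔ j < F (j + t) := by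
    intro t i
    rw [cnt_lt]
    · intro i h
      have := hstep (i + t)
      have e : i + 1 + t = i + t + 1 := by omega
      rw [e] at h; omega
    · have := hF (show N ≤ N + t by omega)
      omega
  obtain ⟨u, -, hu⟩ := hf_surj (F 0 - 1) (fun t => cnt (fun i => i + t < F i) N) (by
      intro t
      constructor
      · by_contra h
        have h1 := (hh (t + 1) (cnt (fun i => i + t < F i) N)).1 (by simpa using h)
        have h2 := (hh t (cnt (fun i => i + t < F i) N)).2 (by omega)
        omega
      · by_contra h
        have h1 := (hh t (cnt (fun i => i + (t + 1) < F i) N + 1)).1 (by simpa using h)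
        have h2 := (hh (t + 1) (cnt (fun i => i + (t + 1) < F i) N)).2 (by
          have := hstep (cnt (fun i => i + (t + 1) < F i) N); omega)
        omega) (by
      intro t
      have := hh t 0
      rw [zero_add] at this
      omega)
  obtain ⟨v, -, hv⟩ := hf_surj (cnt (fun k => 0 < F k) N - 1)
    (fun t => cnt (fun j => j < F (j + t)) N) (by
      intro t
      constructor
      · by_contra h
        have h1 := (hg (t + 1) (cnt (fun i => i < F (i + t)) N)).1 (by simpa using h)
        have h2 := (hg t (cnt (fun i => i < F (i + t)) N)).2 (by
          have := hstep (cnt (fun i => i < F (i + t)) N + t)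
          exact lt_of_lt_of_le h1 this)
        omega
      · by_contra h
        have h1 := (hg t (cnt (fun i => i < F (i + (t + 1))) N + 1)).1 (by simpa using h)
        have h2 := (hg (t + 1) (cnt (fun i => i < F (i + (t + 1))) N)).2 (by
          have e : cnt (fun i => i < F (i + (t + 1))) N + 1 + t
            = cnt (fun i => i < F (i + (t + 1))) N + (t + 1) := by omega
          rw [e] at h1; omega)
        omega) (by
      intro t
      have a := hg t 0
      have b := cnt_conj N F hF hN t 0
      have c := cnt_conj N F hF hN 0 0
      rw [zero_add] at a
      omega)
  refine ⟨u, v, fun i t => ?_, fun j t => ?_⟩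
  · rw [hu, hh]
  · rw [hv, hg]

/-- Pairs of words of total length `n`. -/
def pairs (n : ℕ) : Finset (List Bool × List Bool) :=
  (Finset.HasAntidiagonal.antidiagonal n).biUnion fun p => words p.1 ×ˢ words p.2

theorem mem_pairs (n : ℕ) (p : List Bool × List Bool) :
    p ∈ pairs n ↔ p.1.length + p.2.length = n := by
  simp [pairs, mem_words]

theorem wn_eq (s : Polynomial ℤ) (n : ℕ) :
    wn s n 0 = ∑ p ∈ pairs n, if hf p.1 0 = hf p.2 0 then s ^ com p.1 p.2 else 0 := by
  rw [pairs, Finset.sum_biUnion]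
  · simp only [wn, WW, Finset.sum_product]
    simp
  · intro a _ b _ hab
    rw [Function.onFun, Finset.disjoint_left]
    intro p h1 h2
    simp only [Finset.mem_product, mem_words] at h1 h2
    apply hab
    ext
    · rw [← h1.1, h2.1]
    · rw [← h1.2, h2.2]

theorem coeff_wn (n k : ℕ) : (wn Polynomial.X n 0).coeff k =
    (((pairs n).filter fun p => hf p.1 0 = hf p.2 0 ∧ com p.1 p.2 = k).card : ℤ) := by
  rw [wn_eq, Polynomial.finsetSum_coeff, Finset.card_filter, Nat.cast_sum]
  refine Finset.sum_congr rfl fun p _ => ?_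
  by_cases h : hf p.1 0 = hf p.2 0
  · simp [h, Polynomial.coeff_X_pow, eq_comm]
  · simp [h]

theorem ncard_eq (n k : ℕ) :
    {f : Fin (n + 2) → ℕ | IsBoxPartition (n + 2) f ∧ 1 ≤ conjAt (n + 2) f 1 ∧
      Finset.univ.sup f + conjAt (n + 2) f 1 = n + 2 ∧ dsPart (n + 2) f = k}.ncard
    = ((pairs n).filter fun p => hf p.1 0 = hf p.2 0 ∧ com p.1 p.2 = k).card := by
  rw [← Set.ncard_coe_finset]
  symm
  refine Set.ncard_congr (fun p _ => fun i : Fin (n + 2) => build (n + 2) p.1 p.2 i) ?_ ?_ ?_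
  · rintro ⟨u, v⟩ h
    simp only [Finset.coe_filter, mem_pairs, Set.mem_ofPred_eq] at h ⊢
    obtain ⟨h1, h2, h3⟩ := h
    obtain ⟨b1, b2, b3, b4⟩ := build_props (n + 2) u v h2 (by omega)
    obtain ⟨c1, c2, c3⟩ := b4.props b1 b2 b3
    rw [c3, sup_eq _ _ b1 (by omega), conj_eq, c1, c2]
    exact ⟨box_of _ _ b1 b2, by omega, by omega, h3⟩
  · rintro ⟨u, v⟩ ⟨u', v'⟩ h h' he
    simp only [Finset.coe_filter, mem_pairs, Set.mem_ofPred_eq] at h h'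
    obtain ⟨b1, b2, b3, b4⟩ := build_props (n + 2) u v h.2.1 (by omega)
    obtain ⟨b1', b2', b3', b4'⟩ := build_props (n + 2) u' v' h'.2.1 (by omega)
    have e : build (n + 2) u v = build (n + 2) u' v' := by
      funext i
      by_cases hi : i < n + 2
      · exact congrFun he ⟨i, hi⟩
      · have a := b1 (show n + 2 ≤ i by omega)
        have a' := b1' (show n + 2 ≤ i by omega)
        omega
    rw [e] at b4
    obtain ⟨q1, q2⟩ := b4.uniq b4'
    rw [q1, q2]
  · rintro f ⟨h1, h2, h3, h4⟩
    obtain ⟨F, f1, f2, f3, rfl⟩ := of_box _ f h1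
    rw [sup_eq _ _ f1 (by omega)] at h3
    rw [conj_eq] at h2 h3
    have hp : 1 ≤ F 0 := (cnt_conj _ F f1 f3 0 0).1 h2
    obtain ⟨u, v, hr⟩ := PRel.exists _ F f1 f2 f3 hp
    obtain ⟨c1, c2, c3⟩ := hr.props f1 f2 f3
    have hl : u.length + v.length + 2 = n + 2 := by omega
    refine ⟨(u, v), ?_, ?_⟩
    · simp only [Finset.coe_filter, mem_pairs, Set.mem_ofPred_eq]
      exact ⟨by omega, hr.h0, by omega⟩
    · funext i
      simp only
      have hb := build_lt (n + 2) u v hr.h0 hl i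
      have hc := hr.cell_iff i
      have x1 := hb (F i)
      have x2 := hc (F i)
      have x3 := hb (build (n + 2) u v i)
      have x4 := hc (build (n + 2) u v i)
      rw [← x2] at x1
      rw [← x4] at x3
      omega

theorem ncard_zero (N k : ℕ) (hN : N < 2) :
    {f : Fin N → ℕ | IsBoxPartition N f ∧ 1 ≤ conjAt N f 1 ∧
      Finset.univ.sup f + conjAt N f 1 = N ∧ dsPart N f = k}.ncard = 0 := by
  have : {f : Fin N → ℕ | IsBoxPartition N f ∧ 1 ≤ conjAt N f 1 ∧
      Finset.univ.sup f + conjAt N f 1 = N ∧ dsPart N f = k} = ∅ := by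
    rw [Set.eq_empty_iff_forall_notMem]
    rintro f ⟨h1, h2, h3, h4⟩
    obtain ⟨F, f1, f2, f3, rfl⟩ := of_box _ f h1
    have hN0 : 0 < N := by omega
    rw [sup_eq _ _ f1 hN0] at h3
    rw [conj_eq] at h2 h3
    have hp : 1 ≤ F 0 := (cnt_conj _ F f1 f3 0 0).1 h2
    omega
  rw [this, Set.ncard_empty]

theorem Phi_S : PhiHom (PowerSeries.X ^ 2 * ws Polynomial.X 0) = S := by
  ext d
  change Polynomial.coeff (PowerSeries.coeff (d 1) (PowerSeries.X ^ 2 * ws Polynomial.X 0)) (d 0)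
    = S d
  rw [PowerSeries.coeff_X_pow_mul']
  unfold S
  generalize d 0 = k
  generalize d 1 = N
  split_ifs with h
  · obtain ⟨n, rfl⟩ := Nat.exists_eq_add_of_le' h
    rw [ncard_eq, ← coeff_wn]
    simp [ws]
  · rw [ncard_zero N k (by omega)]
    simp

/-- `(1−2z)·(2(1−s)z² + Q(z))·S = z²·(Q(z) − (1−s)(1−2z))` in `ℤ[[s,z]]`. -/
theorem partition_sp_ds_gf :
    (1 - 2 * MvPowerSeries.X 1)
        * (2 * (1 - MvPowerSeries.X 0) * (MvPowerSeries.X 1) ^ 2 + Q) * S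
      = (MvPowerSeries.X 1) ^ 2
        * (Q - (1 - MvPowerSeries.X 0) * (1 - 2 * MvPowerSeries.X 1)) := by
  have h := congrArg PhiHom (final_ps Polynomial.X)
  have h2 : PhiHom 2 = 2 := map_ofNat _ 2
  rw [map_mul, Phi_S, map_mul, map_mul, map_add, map_sub PhiHom (1 - 2 * PowerSeries.X ^ 2 * cs),
    Phi_Q] at h
  simpa only [map_mul, map_sub, map_add, map_pow, map_one, h2, Phi_X, Phi_C] using h
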